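/- The function p ↦ γ_p = ∫₀^∞ log x dν_{α(p)}(x), where α(p) = (3p − 2 + √(5p² − 8p + 4))/(2p), defined on (0,1], has derivative (log 5)/2 at p = 1 within (0,1] (i.e., its left derivative at 1 equals (log 5)/2). -/

import Mathlib

open MeasureTheory Filter Set Topology

noncomputable section

/-- Endpoints (as pairs of nonnegative integers, `(a,b)` representing `a/b`, with `1/0 = ∞`)
of the Stern-Brocot interval obtained from `[0/1, 1/0]` by following the list of choices `w`
(`true` = left sub-interval, `false` = right sub-interval). -/
def sbGo : (ℕ × ℕ) × (ℕ × ℕ) → List Bool → (ℕ × ℕ) × (ℕ × ℕ)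
  | I, [] => I
  | ((a, b), (c, d)), (lft :: w) =>
      if lft then sbGo ((a, b), (a + c, b + d)) w else sbGo ((a + c, b + d), (c, d)) w

/-- The Stern-Brocot interval of rank `w.length` indexed by the list of choices `w`. -/
def sb (w : List Bool) : (ℕ × ℕ) × (ℕ × ℕ) := sbGo ((0, 1), (1, 0)) w

/-- The intersection of a Stern-Brocot interval with `[0, ∞)`, as a subset of `ℝ`. -/
def sbSet : (ℕ × ℕ) × (ℕ × ℕ) → Set ℝ
  | ((a, b), (c, d)) =>
      if d = 0 then Set.Ici ((a : ℝ) / (b : ℝ))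
      else Set.Icc ((a : ℝ) / (b : ℝ)) ((c : ℝ) / (d : ℝ))

/-- `ν` is the measure `ν_α`: a Borel probability measure on `[0,∞)` (viewed as a measure on `ℝ`
giving no mass to `(-∞,0)`) with `ν([0,1]) = 1 - α`, `ν([1,∞)) = α`, and such that for every
Stern-Brocot interval `I` of rank `r ≥ 1`, the left sub-interval of `I` carries a proportion `α`
of the mass of `I` if `r` is odd and `1 - α` if `r` is even. -/
def IsSternBrocotMeasure (α : ℝ) (ν : Measure ℝ) : Prop :=
  IsProbabilityMeasure ν ∧
  ν (Set.Iio 0) = 0 ∧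
  ν (Set.Icc 0 1) = ENNReal.ofReal (1 - α) ∧
  ν (Set.Ici 1) = ENNReal.ofReal α ∧
  ∀ w : List Bool, 1 ≤ w.length →
    ν (sbSet (sb (w ++ [true]))) =
      (if Odd w.length then ENNReal.ofReal α else ENNReal.ofReal (1 - α)) * ν (sbSet (sb w))

theorem sbGo_append (I : (ℕ × ℕ) × (ℕ × ℕ)) (v w : List Bool) :
    sbGo I (v ++ w) = sbGo (sbGo I v) w := by
  induction v generalizing I with
  | nil => rfl
  | cons b v ih =>
    obtain ⟨⟨a, b'⟩, c, d⟩ := I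
    cases b <;> simp [sbGo, ih]

theorem sb_append_true (w : List Bool) :
    sb (w ++ [true]) = ((sb w).1, (sb w).1 + (sb w).2) := by
  rw [sb, sbGo_append, ← sb]; rfl

theorem sb_append_false (w : List Bool) :
    sb (w ++ [false]) = ((sb w).1 + (sb w).2, (sb w).2) := by
  rw [sb, sbGo_append, ← sb]; rfl

theorem sb_det (w : List Bool) :
    (sb w).1.1 * (sb w).2.2 + 1 = (sb w).1.2 * (sb w).2.1 := by
  induction w using List.reverseRecOn with
  | nil => rfl
  | append_singleton w b ih =>
    cases b
    · rw [sb_append_false]; simp only [Prod.fst_add, Prod.snd_add]; linarith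
    · rw [sb_append_true]; simp only [Prod.fst_add, Prod.snd_add]; linarith

theorem sb_pos (w : List Bool) : 0 < (sb w).1.2 ∧ 0 < (sb w).2.1 := by
  have h := sb_det w
  constructor <;> refine Nat.pos_of_ne_zero fun h0 => ?_ <;> simp [h0] at h

theorem length_add_two_le_sb (w : List Bool) :
    w.length + 2 ≤ (sb w).1.1 + (sb w).1.2 + (sb w).2.1 + (sb w).2.2 := by
  induction w using List.reverseRecOn with
  | nil => rfl
  | append_singleton w b ih =>
    have := sb_pos w
    rw [List.length_append, List.length_singleton]
    cases b
    · rw [sb_append_false]; simp only [Prod.fst_add, Prod.snd_add]; omega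
    · rw [sb_append_true]; simp only [Prod.fst_add, Prod.snd_add]; omega

theorem mem_sbSet_iff {I : (ℕ × ℕ) × (ℕ × ℕ)} (hb : 0 < I.1.2) (hc : 0 < I.2.1) (x : ℝ) :
    x ∈ sbSet I ↔ (I.1.1 : ℝ) ≤ x * I.1.2 ∧ x * I.2.2 ≤ I.2.1 := by
  obtain ⟨⟨a, b⟩, c, d⟩ := I
  have hb' : (0 : ℝ) < b := Nat.cast_pos.2 hb
  have hc' : (0 : ℝ) < c := Nat.cast_pos.2 hc
  rcases Nat.eq_zero_or_pos d with rfl | hd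
  · simp [sbSet, div_le_iff₀ hb', hc'.le]
  · have hd' : (0 : ℝ) < d := Nat.cast_pos.2 hd
    simp [sbSet, hd.ne', div_le_iff₀ hb', le_div_iff₀ hd']

theorem mem_sbSet_sb (w : List Bool) (x : ℝ) :
    x ∈ sbSet (sb w) ↔ ((sb w).1.1 : ℝ) ≤ x * (sb w).1.2 ∧ x * (sb w).2.2 ≤ (sb w).2.1 :=
  mem_sbSet_iff (sb_pos w).1 (sb_pos w).2 x

theorem measurableSet_sbSet (I : (ℕ × ℕ) × (ℕ × ℕ)) : MeasurableSet (sbSet I) := by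
  obtain ⟨⟨a, b⟩, c, d⟩ := I
  simp only [sbSet]
  split_ifs
  exacts [measurableSet_Ici, measurableSet_Icc]

/-- The left endpoint of the Stern-Brocot interval indexed by `w`. -/
def sbLeft (w : List Bool) : ℝ := (sb w).1.1 / (sb w).1.2

theorem sbLeft_append_true (w : List Bool) : sbLeft (w ++ [true]) = sbLeft w := by
  simp [sbLeft, sb_append_true]

theorem sbLeft_mem (w : List Bool) : sbLeft w ∈ sbSet (sb w) := by
  have hb : (0 : ℝ) < (sb w).1.2 := Nat.cast_pos.2 (sb_pos w).1
  have h : ((sb w).1.1 : ℝ) * (sb w).2.2 + 1 = (sb w).1.2 * (sb w).2.1 := by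
    exact_mod_cast sb_det w
  rw [mem_sbSet_sb, sbLeft]
  constructor
  · rw [div_mul_cancel₀ _ hb.ne']
  · rw [div_mul_eq_mul_div, div_le_iff₀ hb]; linarith

theorem mem_sbSet_append_false (w : List Bool) (x : ℝ) :
    x ∈ sbSet (sb (w ++ [false])) ↔ x ∈ sbSet (sb w) ∧ sbLeft (w ++ [false]) ≤ x := by
  have hb : (0 : ℝ) < (sb (w ++ [false])).1.2 := Nat.cast_pos.2 (sb_pos _).1
  rw [mem_sbSet_sb, mem_sbSet_sb, sbLeft, div_le_iff₀ hb, sb_append_false]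
  simp only [Prod.fst_add, Prod.snd_add]
  push_cast
  constructor
  · rintro ⟨h1, h2⟩; exact ⟨⟨by linarith, h2⟩, h1⟩
  · rintro ⟨⟨h1, h2⟩, h3⟩; exact ⟨h3, h2⟩

theorem mem_sbSet_append_true (w : List Bool) (x : ℝ) :
    x ∈ sbSet (sb (w ++ [true])) ↔ x ∈ sbSet (sb w) ∧ x ≤ sbLeft (w ++ [false]) := by
  have hb : (0 : ℝ) < (sb (w ++ [false])).1.2 := Nat.cast_pos.2 (sb_pos _).1
  rw [mem_sbSet_sb, mem_sbSet_sb, sbLeft, le_div_iff₀ hb, sb_append_false, sb_append_true]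
  simp only [Prod.fst_add, Prod.snd_add]
  push_cast
  constructor
  · rintro ⟨h1, h2⟩; exact ⟨⟨h1, by linarith⟩, h2⟩
  · rintro ⟨⟨h1, h2⟩, h3⟩; exact ⟨h1, h3⟩

theorem measureReal_sbSet_inter (ν : Measure ℝ) [IsFiniteMeasure ν] (w : List Bool)
    (hw : ν.real {sbLeft (w ++ [false])} = 0) (s : Set ℝ) (hs : MeasurableSet s) :
    ν.real (sbSet (sb w) ∩ s) = ν.real (sbSet (sb (w ++ [true])) ∩ s) +
      ν.real (sbSet (sb (w ++ [false])) ∩ s) := by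
  have hunion : sbSet (sb w) ∩ s =
      (sbSet (sb (w ++ [true])) ∩ s) ∪ (sbSet (sb (w ++ [false])) ∩ s) := by
    ext x
    have := le_total x (sbLeft (w ++ [false]))
    simp only [Set.mem_inter_iff, Set.mem_union, mem_sbSet_append_true, mem_sbSet_append_false]
    tauto
  have hinter : ν.real ((sbSet (sb (w ++ [true])) ∩ s) ∩ (sbSet (sb (w ++ [false])) ∩ s)) = 0 := by
    refine le_antisymm (hw ▸ measureReal_mono fun x hx => ?_) measureReal_nonneg
    simp only [Set.mem_inter_iff, mem_sbSet_append_true, mem_sbSet_append_false] at hx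
    exact le_antisymm hx.1.1.2 hx.2.1.2
  have := measureReal_union_add_inter (μ := ν) (s := sbSet (sb (w ++ [true])) ∩ s)
    ((measurableSet_sbSet (sb (w ++ [false]))).inter hs)
  rw [hunion]; linarith

/-- The proportion of mass that `ν_α` gives to the left (`b = true`) or right (`b = false`)
sub-interval of a Stern-Brocot interval of rank `r`. -/
def sbWeight (α : ℝ) (r : ℕ) (b : Bool) : ℝ := if b = true ↔ Odd r then α else 1 - α

theorem sbWeight_succ (α : ℝ) (r : ℕ) (b : Bool) : sbWeight α (r + 1) b = sbWeight α r (!b) := by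
  cases b <;> simp [sbWeight, Nat.odd_add_one]

theorem sbWeight_not (α : ℝ) (r : ℕ) (b : Bool) : sbWeight α r (!b) = 1 - sbWeight α r b := by
  cases b <;> by_cases h : Odd r <;> simp [sbWeight, h]

variable {α : ℝ} {ν : Measure ℝ}

namespace IsSternBrocotMeasure

theorem sbSet_sb_true : sbSet (sb [true]) = Set.Icc 0 1 := by
  simp [sb, sbGo, sbSet]

theorem sbSet_sb_false : sbSet (sb [false]) = Set.Ici 1 := by
  simp [sb, sbGo, sbSet]

theorem sbSet_sb_nil : sbSet (sb []) = Set.Ici 0 := by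
  simp [sb, sbGo, sbSet]

theorem real_append_true (h : IsSternBrocotMeasure α ν) (hα : α ∈ Set.Icc (0 : ℝ) 1)
    {w : List Bool} (hw : 1 ≤ w.length) :
    ν.real (sbSet (sb (w ++ [true]))) = sbWeight α w.length true * ν.real (sbSet (sb w)) := by
  have h1 := sub_nonneg.2 hα.2
  rw [measureReal_def, h.2.2.2.2 w hw, ENNReal.toReal_mul, sbWeight, measureReal_def]
  by_cases hodd : Odd w.length
  · simp only [hodd, if_true, ENNReal.toReal_ofReal hα.1]
  · simp only [hodd, if_false, iff_false, not_true_eq_false, ENNReal.toReal_ofReal h1]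

theorem real_sbLeft_le (h : IsSternBrocotMeasure α ν) (hα : α ∈ Set.Icc (0 : ℝ) 1) (n : ℕ)
    {w : List Bool} (hw : 1 ≤ w.length) :
    ν.real {sbLeft w} ≤ (1 / 4) ^ n * ν.real (sbSet (sb w)) := by
  have := h.1
  induction n generalizing w with
  | zero =>
    simpa using measureReal_mono (μ := ν) (Set.singleton_subset_iff.2 (sbLeft_mem w))
  | succ n ih =>
    have hw1 : 1 ≤ (w ++ [true]).length := by simp
    have hw2 : 1 ≤ (w ++ [true] ++ [true]).length := by simp
    have h2 := ih hw2
    rw [sbLeft_append_true, sbLeft_append_true, real_append_true h hα hw1,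
      real_append_true h hα hw, List.length_append, List.length_singleton, sbWeight_succ,
      sbWeight_not] at h2
    refine h2.trans ?_
    have h3 : (1 - sbWeight α w.length true) * sbWeight α w.length true ≤ 1 / 4 := by
      nlinarith [sq_nonneg (sbWeight α w.length true - 1 / 2)]
    rw [← mul_assoc (1 - _), pow_succ, mul_assoc ((1 / 4 : ℝ) ^ n)]
    exact mul_le_mul_of_nonneg_left (mul_le_mul_of_nonneg_right h3 measureReal_nonneg)
      (by positivity)

theorem real_sbLeft (h : IsSternBrocotMeasure α ν) (hα : α ∈ Set.Icc (0 : ℝ) 1)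
    (w : List Bool) : ν.real {sbLeft w} = 0 := by
  have key : ∀ w : List Bool, 1 ≤ w.length → ν.real {sbLeft w} = 0 := by
    intro w hw
    have hlim := (tendsto_pow_atTop_nhds_zero_of_lt_one (r := (1 / 4 : ℝ))
      (by norm_num) (by norm_num)).mul_const (ν.real (sbSet (sb w)))
    rw [zero_mul] at hlim
    exact le_antisymm (ge_of_tendsto' hlim fun n => h.real_sbLeft_le hα n hw) measureReal_nonneg
  rw [← sbLeft_append_true]
  exact key _ (by simp)

theorem real_sb_nil (h : IsSternBrocotMeasure α ν) : ν.real (sbSet (sb [])) = 1 := by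
  have := h.1
  rw [sbSet_sb_nil, ← Set.compl_Iio, probReal_compl_eq_one_sub measurableSet_Iio, measureReal_def,
    h.2.1]
  simp

theorem real_append (h : IsSternBrocotMeasure α ν) (hα : α ∈ Set.Icc (0 : ℝ) 1)
    (w : List Bool) (b : Bool) :
    ν.real (sbSet (sb (w ++ [b]))) = sbWeight α w.length b * ν.real (sbSet (sb w)) := by
  have := h.1
  have key : ν.real (sbSet (sb (w ++ [true]))) =
      sbWeight α w.length true * ν.real (sbSet (sb w)) := by
    rcases w with _ | ⟨b, w⟩
    · rw [h.real_sb_nil, List.nil_append, sbSet_sb_true, measureReal_def, h.2.2.1,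
        ENNReal.toReal_ofReal (sub_nonneg.2 hα.2)]
      simp [sbWeight]
    · exact h.real_append_true hα (by simp)
  cases b
  · have h1 := measureReal_sbSet_inter ν w (h.real_sbLeft hα _) Set.univ MeasurableSet.univ
    simp only [Set.inter_univ] at h1
    rw [← Bool.not_true, sbWeight_not, Bool.not_true]
    linarith
  · exact key

theorem real_cons (h : IsSternBrocotMeasure α ν) (hα : α ∈ Set.Icc (0 : ℝ) 1)
    (b : Bool) (v : List Bool) :
    ν.real (sbSet (sb (b :: v))) = sbWeight α 0 b * ν.real (sbSet (sb (v.map not))) := by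
  induction v using List.reverseRecOn with
  | nil => exact h.real_append hα [] b
  | append_singleton v c ih =>
    rw [← List.cons_append, h.real_append hα, ih, List.map_append, List.map_singleton,
      h.real_append hα, List.length_cons, List.length_map, sbWeight_succ]
    ring

theorem ae_pos (h : IsSternBrocotMeasure α ν) (hα : α ∈ Set.Icc (0 : ℝ) 1) :
    ∀ᵐ x ∂ν, 0 < x := by
  have := h.1
  have h0 : ν {0} = 0 := by
    have := h.real_sbLeft hα []
    rwa [measureReal_eq_zero_iff, show sbLeft [] = 0 by simp [sbLeft, sb, sbGo]] at this
  have h1 : ν (Set.Iio 0 ∪ {0}) = 0 := measure_union_null h.2.1 h0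
  rw [Set.Iio_union_right] at h1
  simpa [ae_iff, Set.Iic] using h1

theorem real_inter_Iic_eq {μ : Measure ℝ} (h : IsSternBrocotMeasure α ν)
    (hμ : IsSternBrocotMeasure α μ) (hα : α ∈ Set.Icc (0 : ℝ) 1)
    (heq : ∀ w, μ.real (sbSet (sb w)) = ν.real (sbSet (sb w))) (s t n : ℕ) (ht : 0 < t)
    (w : List Bool) (hn : s + t < w.length + 2 + n) :
    μ.real (sbSet (sb w) ∩ Set.Iic (s / t : ℝ)) = ν.real (sbSet (sb w) ∩ Set.Iic (s / t : ℝ)) := by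
  have := h.1
  have := hμ.1
  have ht' : (0 : ℝ) < t := Nat.cast_pos.2 ht
  have hb : (0 : ℝ) < (sb w).1.2 := Nat.cast_pos.2 (sb_pos w).1
  rcases le_or_gt (s / t : ℝ) (sbLeft w) with hle | hlt
  · have hsub : sbSet (sb w) ∩ Set.Iic (s / t : ℝ) ⊆ {sbLeft w} := by
      rintro x ⟨hx, hxq⟩
      refine le_antisymm (hxq.trans hle) ?_
      rw [sbLeft, div_le_iff₀ hb]
      exact ((mem_sbSet_sb w x).1 hx).1
    have hnull : ∀ ρ : Measure ℝ, IsSternBrocotMeasure α ρ →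
        ρ.real (sbSet (sb w) ∩ Set.Iic (s / t : ℝ)) = 0 := fun ρ hρ => by
      have := hρ.1
      exact le_antisymm ((measureReal_mono hsub).trans (hρ.real_sbLeft hα w).le)
        measureReal_nonneg
    rw [hnull μ hμ, hnull ν h]
  rcases le_or_gt ((sb w).2.1 * t) (s * (sb w).2.2) with hge | hint
  · have hsub : sbSet (sb w) ⊆ Set.Iic (s / t : ℝ) := by
      intro x hx
      have h2 := ((mem_sbSet_sb w x).1 hx).2
      have h3 : ((sb w).2.1 * t : ℝ) ≤ s * (sb w).2.2 := by exact_mod_cast hge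
      have hd : (0 : ℝ) < (sb w).2.2 := by
        have h4 : 0 < (sb w).2.1 * t := Nat.mul_pos (sb_pos w).2 ht
        exact Nat.cast_pos.2 (Nat.pos_of_ne_zero fun h0 => by
          rw [h0, mul_zero] at hge
          omega)
      rw [Set.mem_Iic, le_div_iff₀ ht']
      refine le_of_mul_le_mul_right ?_ hd
      nlinarith
    rw [Set.inter_eq_left.2 hsub, heq]
  cases n with
  | zero =>
    exfalso
    rw [sbLeft, div_lt_div_iff₀ hb ht'] at hlt
    have h1 : (sb w).1.1 * t < s * (sb w).1.2 := by exact_mod_cast hlt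
    have h2 := sb_det w
    have h3 := length_add_two_le_sb w
    revert h1 h2 h3 hint hn
    generalize (sb w).1.1 = a
    generalize (sb w).1.2 = b
    generalize (sb w).2.1 = c
    generalize (sb w).2.2 = d
    intro hn h0 h1 h2 h3
    zify at *
    have hs : (s : ℤ) = a * (c * t - s * d) + c * (s * b - a * t) := by linear_combination s * h2
    have ht : (t : ℤ) = b * (c * t - s * d) + d * (s * b - a * t) := by linear_combination t * h2
    have e1 : (1 : ℤ) ≤ c * t - s * d := by linarith
    have e2 : (1 : ℤ) ≤ s * b - a * t := by linarith
    nlinarith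
  | succ n =>
    rw [measureReal_sbSet_inter μ w (hμ.real_sbLeft hα _) _ measurableSet_Iic,
      measureReal_sbSet_inter ν w (h.real_sbLeft hα _) _ measurableSet_Iic,
      real_inter_Iic_eq h hμ hα heq s t n ht _ (by simp; omega),
      real_inter_Iic_eq h hμ hα heq s t n ht _ (by simp; omega)]

theorem unique {μ : Measure ℝ} (h : IsSternBrocotMeasure α ν)
    (hμ : IsSternBrocotMeasure α μ) (hα : α ∈ Set.Icc (0 : ℝ) 1) : μ = ν := by
  have := h.1
  have := hμ.1
  have heq : ∀ w, μ.real (sbSet (sb w)) = ν.real (sbSet (sb w)) := by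
    intro w
    induction w using List.reverseRecOn with
    | nil => rw [h.real_sb_nil, hμ.real_sb_nil]
    | append_singleton w b ih => rw [h.real_append hα, hμ.real_append hα, ih]
  refine ext_of_generate_finite _ Real.borel_eq_generateFrom_Iic_rat Real.isPiSystem_Iic_rat ?_
    (by simp)
  intro s hs
  simp only [Set.mem_iUnion, Set.mem_singleton_iff] at hs
  obtain ⟨q, rfl⟩ := hs
  rcases lt_or_ge q 0 with hq | hq
  · have hsub : Set.Iic (q : ℝ) ⊆ Set.Iio 0 := Set.Iic_subset_Iio.2 (by exact_mod_cast hq)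
    rw [measure_mono_null hsub hμ.2.1, measure_mono_null hsub h.2.1]
  · have hq' : (q : ℝ) = (q.num.toNat : ℝ) / (q.den : ℝ) := by
      have h1 : ((q.num.toNat : ℤ) : ℝ) = (q.num : ℝ) := by
        rw [Int.toNat_of_nonneg (Rat.num_nonneg.2 hq)]
      rw [← Int.cast_natCast q.num.toNat, h1, ← Rat.cast_def]
    have hae : ∀ ρ : Measure ℝ, ρ (Set.Iio 0) = 0 →
        ρ (Set.Iic (q : ℝ)) = ρ (sbSet (sb []) ∩ Set.Iic (q : ℝ)) := by
      intro ρ hρ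
      rw [sbSet_sb_nil]
      refine (Measure.measure_inter_eq_of_ae ?_).symm
      exact ae_iff.2 (by simpa [Set.Iio] using hρ)
    rw [hae μ hμ.2.1, hae ν h.2.1, ← measureReal_eq_measureReal_iff, hq']
    exact h.real_inter_Iic_eq hμ hα heq _ _ _ q.den_pos []
      (Nat.lt_add_of_pos_left (by simp))

end IsSternBrocotMeasure

/-- The image of a Stern-Brocot interval under `x ↦ 1 + 1 / x`. -/
def sbOneAddInv (I : (ℕ × ℕ) × (ℕ × ℕ)) : (ℕ × ℕ) × (ℕ × ℕ) :=
  ((I.2.1 + I.2.2, I.2.1), (I.1.1 + I.1.2, I.1.1))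

/-- The image of a Stern-Brocot interval under `x ↦ 1 / (1 + x)`. -/
def sbInvOneAdd (I : (ℕ × ℕ) × (ℕ × ℕ)) : (ℕ × ℕ) × (ℕ × ℕ) :=
  ((I.2.2, I.2.1 + I.2.2), (I.1.2, I.1.1 + I.1.2))

theorem sbGo_sbOneAddInv (I : (ℕ × ℕ) × (ℕ × ℕ)) (v : List Bool) :
    sbGo (sbOneAddInv I) v = sbOneAddInv (sbGo I (v.map not)) := by
  induction v generalizing I with
  | nil => rfl
  | cons b v ih =>
    obtain ⟨⟨a, b'⟩, c, d⟩ := I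
    cases b <;> simp only [sbGo, List.map_cons, Bool.not_true, Bool.not_false, if_true,
      Bool.false_eq_true, if_false, ← ih] <;> simp only [sbOneAddInv, add_comm,
      add_left_comm]

theorem sbGo_sbInvOneAdd (I : (ℕ × ℕ) × (ℕ × ℕ)) (v : List Bool) :
    sbGo (sbInvOneAdd I) v = sbInvOneAdd (sbGo I (v.map not)) := by
  induction v generalizing I with
  | nil => rfl
  | cons b v ih =>
    obtain ⟨⟨a, b'⟩, c, d⟩ := I
    cases b <;> simp only [sbGo, List.map_cons, Bool.not_true, Bool.not_false, if_true,
      Bool.false_eq_true, if_false, ← ih] <;> simp only [sbInvOneAdd, add_comm,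
      add_left_comm]

theorem sb_cons_false (v : List Bool) : sb (false :: v) = sbOneAddInv (sb (v.map not)) :=
  sbGo_sbOneAddInv ((0, 1), (1, 0)) v

theorem sb_cons_true (v : List Bool) : sb (true :: v) = sbInvOneAdd (sb (v.map not)) :=
  sbGo_sbInvOneAdd ((0, 1), (1, 0)) v

theorem one_add_inv_mem_sbSet_cons_false {x : ℝ} (hx : 0 < x) (v : List Bool) :
    1 + 1 / x ∈ sbSet (sb (false :: v)) ↔ x ∈ sbSet (sb (v.map not)) := by
  rw [mem_sbSet_sb, mem_sbSet_sb, sb_cons_false]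
  simp only [sbOneAddInv]
  push_cast
  have hx' : 1 / x * x = 1 := by field_simp
  rw [← mul_le_mul_iff_left₀ hx, ← mul_le_mul_iff_left₀ (b := (1 + 1 / x) * _) hx, and_comm]
  constructor <;> rintro ⟨h1, h2⟩ <;> constructor <;> field_simp at * <;> linarith

theorem inv_one_add_mem_sbSet_cons_true {x : ℝ} (hx : 0 < x) (v : List Bool) :
    1 / (1 + x) ∈ sbSet (sb (true :: v)) ↔ x ∈ sbSet (sb (v.map not)) := by
  rw [mem_sbSet_sb, mem_sbSet_sb, sb_cons_true]
  simp only [sbInvOneAdd]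
  push_cast
  have hx' : 0 < 1 + x := by linarith
  rw [div_mul_eq_mul_div, div_mul_eq_mul_div, le_div_iff₀ hx', div_le_iff₀ hx', and_comm]
  constructor <;> rintro ⟨h1, h2⟩ <;> constructor <;> linarith

theorem sbSet_append_subset (v w : List Bool) : sbSet (sb (v ++ w)) ⊆ sbSet (sb v) := by
  induction w using List.reverseRecOn with
  | nil => simp
  | append_singleton w b ih =>
    refine subset_trans (fun x hx => ?_) ih
    rw [← List.append_assoc] at hx
    cases b
    · exact ((mem_sbSet_append_false _ x).1 hx).1
    · exact ((mem_sbSet_append_true _ x).1 hx).1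

theorem one_add_inv_notMem_sbSet_cons_true {x : ℝ} (hx : 0 < x) (v : List Bool) :
    1 + 1 / x ∉ sbSet (sb (true :: v)) := fun h => by
  have h1 := sbSet_append_subset [true] v h
  rw [IsSternBrocotMeasure.sbSet_sb_true] at h1
  have : 0 < 1 / x := by positivity
  linarith [h1.2]

theorem inv_one_add_notMem_sbSet_cons_false {x : ℝ} (hx : 0 < x) (v : List Bool) :
    1 / (1 + x) ∉ sbSet (sb (false :: v)) := fun h => by
  have h1 := sbSet_append_subset [false] v h
  rw [IsSternBrocotMeasure.sbSet_sb_false] at h1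
  have : 1 / (1 + x) < 1 := by rw [div_lt_one (by linarith)]; linarith
  exact absurd h1 (not_le.2 this)

theorem measurable_one_add_inv : Measurable fun x : ℝ => 1 + 1 / x := by fun_prop

theorem measurable_inv_one_add : Measurable fun x : ℝ => 1 / (1 + x) := by fun_prop

/-- The law of `1 + 1 / X` with probability `α` and `1 / (1 + X)` with probability `1 - α`,
where `X` has law `ν`. -/
def sbStep (α : ℝ) (ν : Measure ℝ) : Measure ℝ :=
  ENNReal.ofReal α • ν.map (fun x => 1 + 1 / x) +
    ENNReal.ofReal (1 - α) • ν.map (fun x => 1 / (1 + x))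

theorem sbStep_apply (α : ℝ) (ν : Measure ℝ) {s : Set ℝ} (hs : MeasurableSet s) :
    sbStep α ν s = ENNReal.ofReal α * ν ((fun x => 1 + 1 / x) ⁻¹' s) +
      ENNReal.ofReal (1 - α) * ν ((fun x => 1 / (1 + x)) ⁻¹' s) := by
  simp only [sbStep, Measure.add_apply, Measure.smul_apply, smul_eq_mul,
    Measure.map_apply measurable_one_add_inv hs, Measure.map_apply measurable_inv_one_add hs]

namespace IsSternBrocotMeasure

theorem sbStep_sbSet (h : IsSternBrocotMeasure α ν) (hα : α ∈ Set.Icc (0 : ℝ) 1)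
    (w : List Bool) : sbStep α ν (sbSet (sb w)) = ν (sbSet (sb w)) := by
  have := h.1
  have hpos := h.ae_pos hα
  have hnot : ∀ s : Set ℝ, (∀ x, 0 < x → x ∉ s) → ν s = 0 := fun s hs =>
    measure_eq_zero_iff_ae_notMem.2 (hpos.mono hs)
  have hcongr : ∀ s t : Set ℝ, (∀ x, 0 < x → (x ∈ s ↔ x ∈ t)) → ν s = ν t := fun s t hs =>
    measure_congr (eventuallyEq_set.2 (hpos.mono hs))
  have hofReal : ∀ s : Set ℝ, ν s = ENNReal.ofReal (ν.real s) := fun s =>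
    (ofReal_measureReal).symm
  rw [sbStep_apply _ _ (measurableSet_sbSet _)]
  rcases w with _ | ⟨_ | _, v⟩
  · rw [sbSet_sb_nil, hcongr (_ ⁻¹' Set.Ici 0) Set.univ,
      hcongr ((fun x => 1 / (1 + x)) ⁻¹' Set.Ici 0) Set.univ, hcongr (Set.Ici 0) Set.univ,
      measure_univ, mul_one, mul_one, ← ENNReal.ofReal_add hα.1 (sub_nonneg.2 hα.2)]
    · simp
    · intro x hx; simp [hx.le]
    · intro x hx; simp only [Set.mem_preimage, Set.mem_Ici, Set.mem_univ, iff_true]; positivity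
    · intro x hx; simp only [Set.mem_preimage, Set.mem_Ici, Set.mem_univ, iff_true]; positivity
  · rw [hcongr ((fun x => 1 + 1 / x) ⁻¹' sbSet (sb (false :: v))) (sbSet (sb (v.map not)))
        fun x hx => one_add_inv_mem_sbSet_cons_false hx v,
      hnot ((fun x => 1 / (1 + x)) ⁻¹' sbSet (sb (false :: v)))
        fun x hx => inv_one_add_notMem_sbSet_cons_false hx v,
      mul_zero, add_zero, hofReal (sbSet (sb (false :: v))), h.real_cons hα, hofReal,
      ← ENNReal.ofReal_mul hα.1]
    simp [sbWeight]
  · rw [hcongr ((fun x => 1 / (1 + x)) ⁻¹' sbSet (sb (true :: v))) (sbSet (sb (v.map not)))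
        fun x hx => inv_one_add_mem_sbSet_cons_true hx v,
      hnot ((fun x => 1 + 1 / x) ⁻¹' sbSet (sb (true :: v)))
        fun x hx => one_add_inv_notMem_sbSet_cons_true hx v,
      mul_zero, zero_add, hofReal (sbSet (sb (true :: v))), h.real_cons hα, hofReal,
      ← ENNReal.ofReal_mul (sub_nonneg.2 hα.2)]
    simp [sbWeight]

theorem sbStep_eq (h : IsSternBrocotMeasure α ν) (hα : α ∈ Set.Icc (0 : ℝ) 1) :
    sbStep α ν = ν := by
  have := h.1
  have hpos := h.ae_pos hα
  refine h.unique ⟨⟨?_⟩, ?_, ?_, ?_, fun w hw => ?_⟩ hα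
  · rw [sbStep_apply _ _ MeasurableSet.univ]
    simp only [Set.preimage_univ, measure_univ, mul_one]
    rw [← ENNReal.ofReal_add hα.1 (sub_nonneg.2 hα.2)]
    simp
  · rw [sbStep_apply _ _ measurableSet_Iio]
    have h1 : ν ((fun x => 1 + 1 / x) ⁻¹' Set.Iio 0) = 0 :=
      measure_eq_zero_iff_ae_notMem.2 (hpos.mono fun x hx => by
        simp only [Set.mem_preimage, Set.mem_Iio, not_lt]; positivity)
    have h2 : ν ((fun x => 1 / (1 + x)) ⁻¹' Set.Iio 0) = 0 :=
      measure_eq_zero_iff_ae_notMem.2 (hpos.mono fun x hx => by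
        simp only [Set.mem_preimage, Set.mem_Iio, not_lt]; positivity)
    rw [h1, h2, mul_zero, mul_zero, add_zero]
  · rw [← sbSet_sb_true, h.sbStep_sbSet hα, sbSet_sb_true, h.2.2.1]
  · rw [← sbSet_sb_false, h.sbStep_sbSet hα, sbSet_sb_false, h.2.2.2.1]
  · rw [h.sbStep_sbSet hα, h.sbStep_sbSet hα, h.2.2.2.2 w hw]

theorem integral_eq (h : IsSternBrocotMeasure α ν) (hα : α ∈ Set.Icc (0 : ℝ) 1)
    {f : ℝ → ℝ} (hf : Integrable f ν) (hfm : Measurable f) :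
    ∫ x, f x ∂ν = α * ∫ x, f (1 + 1 / x) ∂ν + (1 - α) * ∫ x, f (1 / (1 + x)) ∂ν := by
  have hf' := hf
  rw [← h.sbStep_eq hα, sbStep, integrable_add_measure] at hf'
  conv_lhs => rw [← h.sbStep_eq hα, sbStep]
  rw [integral_add_measure hf'.1 hf'.2, integral_smul_measure, integral_smul_measure,
    integral_map measurable_one_add_inv.aemeasurable hfm.aestronglyMeasurable,
    integral_map measurable_inv_one_add.aemeasurable hfm.aestronglyMeasurable,
    ENNReal.toReal_ofReal hα.1, ENNReal.toReal_ofReal (sub_nonneg.2 hα.2), smul_eq_mul, smul_eq_mul]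

end IsSternBrocotMeasure

open Real (goldenRatio)

theorem abs_log_comp_sub_log_comp_le {f : ℝ → ℝ} (hf : ∀ x, 0 < x → 0 < f x)
    (h : ∀ x y, 0 < x → x ≤ y → f x * x ≤ f y * y ∧ f y * x ≤ f x * y) {x y : ℝ}
    (hx : 0 < x) (hy : 0 < y) :
    |Real.log (f x) - Real.log (f y)| ≤ |Real.log x - Real.log y| := by
  wlog hxy : x ≤ y generalizing x y
  · rw [abs_sub_comm, abs_sub_comm (Real.log x)]
    exact this hy hx (le_of_not_ge hxy)
  have hfx := hf x hx
  have hfy := hf y hy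
  obtain ⟨h1, h2⟩ := h x y hx hxy
  have h1' := Real.log_le_log (by positivity) h1
  have h2' := Real.log_le_log (by positivity) h2
  rw [Real.log_mul hfx.ne' hx.ne', Real.log_mul hfy.ne' hy.ne'] at h1'
  rw [Real.log_mul hfy.ne' hx.ne', Real.log_mul hfx.ne' hy.ne'] at h2'
  rw [abs_sub_comm (Real.log x), abs_of_nonneg (sub_nonneg.2 (Real.log_le_log hx hxy)), abs_le]
  constructor <;> linarith

theorem abs_log_one_add_inv_sub_le {x y : ℝ} (hx : 0 < x) (hy : 0 < y) :
    |Real.log (1 + 1 / x) - Real.log (1 + 1 / y)| ≤ |Real.log x - Real.log y| := by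
  refine abs_log_comp_sub_log_comp_le (f := fun x => 1 + 1 / x) (fun x hx => by positivity)
    (fun x y hx hxy => ?_) hx hy
  have hy := hx.trans_le hxy
  have h1 : 0 ≤ x * y * (y - x) := mul_nonneg (by positivity) (sub_nonneg.2 hxy)
  constructor <;> field_simp <;> nlinarith

theorem abs_log_inv_one_add_sub_le {x y : ℝ} (hx : 0 < x) (hy : 0 < y) :
    |Real.log (1 / (1 + x)) - Real.log (1 / (1 + y))| ≤ |Real.log x - Real.log y| := by
  refine abs_log_comp_sub_log_comp_le (f := fun x => 1 / (1 + x)) (fun x hx => by positivity)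
    (fun x y hx hxy => ?_) hx hy
  have hy := hx.trans_le hxy
  constructor <;> field_simp <;> nlinarith

theorem abs_log_add_const_sub_le {c x y : ℝ} (hc : 0 < c) (hx : 0 < x) (hy : 0 < y) :
    |Real.log (x + c) - Real.log (y + c)| ≤ |Real.log x - Real.log y| := by
  refine abs_log_comp_sub_log_comp_le (f := fun x => x + c) (fun x hx => by positivity)
    (fun x y hx hxy => ?_) hx hy
  constructor <;> nlinarith

theorem abs_log_one_add_inv_iterate_sub_le {x y : ℝ} (hx : 0 < x) (hy : 0 < y) :
    |Real.log (1 + 1 / (1 + 1 / x)) - Real.log (1 + 1 / (1 + 1 / y))| ≤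
      |Real.log x - Real.log y| / 2 := by
  have := abs_log_comp_sub_log_comp_le (f := fun x => (1 + 1 / (1 + 1 / x)) ^ 2)
    (fun x hx => by positivity) (fun x y hx hxy => ?_) hx hy
  · simp only [Real.log_pow, ← mul_sub, abs_mul] at this
    norm_num at this ⊢
    linarith
  have hy := hx.trans_le hxy
  have e : ∀ z : ℝ, 0 < z → 1 + 1 / (1 + 1 / z) = (2 * z + 1) / (z + 1) := fun z hz => by
    field_simp; ring
  simp only [e x hx, e y hy]
  obtain ⟨t, ht, rfl⟩ : ∃ t, 0 ≤ t ∧ y = x + t := ⟨y - x, sub_nonneg.2 hxy, by ring⟩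
  constructor
  · gcongr ?_ ^ 2 * ?_
    rw [div_le_div_iff₀ (by positivity) (by positivity)]
    nlinarith
  · rw [div_pow, div_pow, div_mul_eq_mul_div, div_mul_eq_mul_div,
      div_le_div_iff₀ (by positivity) (by positivity), ← sub_nonneg]
    ring_nf
    positivity

theorem one_add_inv_goldenRatio : 1 + 1 / goldenRatio = goldenRatio := by
  have h1 := Real.goldenRatio_sq
  have h2 := Real.goldenRatio_pos
  generalize goldenRatio = φ at *
  field_simp
  linarith

/-- The distance of `x` to the golden ratio in logarithmic scale. -/
def logDist (x : ℝ) : ℝ := |Real.log x - Real.log goldenRatio|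

theorem logDist_nonneg (x : ℝ) : 0 ≤ logDist x := abs_nonneg _

theorem measurable_logDist : Measurable logDist := by unfold logDist; fun_prop

theorem logDist_one_add_inv_le {x : ℝ} (hx : 0 < x) : logDist (1 + 1 / x) ≤ logDist x := by
  have h := abs_log_one_add_inv_sub_le hx Real.goldenRatio_pos
  rwa [one_add_inv_goldenRatio] at h

theorem logDist_one_add_inv_iterate_le {x : ℝ} (hx : 0 < x) :
    logDist (1 + 1 / (1 + 1 / x)) ≤ logDist x / 2 := by
  have h := abs_log_one_add_inv_iterate_sub_le hx Real.goldenRatio_pos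
  rwa [one_add_inv_goldenRatio, one_add_inv_goldenRatio] at h

theorem logDist_inv_one_add_le {x : ℝ} (hx : 0 < x) :
    logDist (1 / (1 + x)) ≤ logDist x + logDist (1 / (1 + goldenRatio)) :=
  (abs_sub_le _ (Real.log (1 / (1 + goldenRatio))) _).trans
    (add_le_add_left (abs_log_inv_one_add_sub_le hx Real.goldenRatio_pos) _)

theorem logDist_one_add_inv_iterate_le_one {x : ℝ} (hx : 0 < x) :
    logDist (1 + 1 / (1 + 1 / x)) ≤ 1 := by
  have key : ∀ z : ℝ, 1 ≤ z → z ≤ 2 → 0 ≤ Real.log z ∧ Real.log z ≤ 1 := fun z h1 h2 =>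
    ⟨Real.log_nonneg h1, by linarith [Real.log_le_sub_one_of_pos (x := z) (by linarith)]⟩
  have h1 := key (1 + 1 / (1 + 1 / x)) (by simp; positivity) (by
    have : 1 / (1 + 1 / x) ≤ 1 := by
      rw [div_le_one (by positivity)]; simp [hx.le]
    linarith)
  have h2 := key goldenRatio Real.one_lt_goldenRatio.le Real.goldenRatio_lt_two.le
  rw [logDist, abs_le]
  constructor <;> linarith

namespace IsSternBrocotMeasure

theorem integral_min_logDist_le (h : IsSternBrocotMeasure α ν) (hα : α ∈ Set.Icc (7 / 8 : ℝ) 1)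
    {M : ℝ} (hM : 2 ≤ M) :
    ∫ x, min (logDist x) M ∂ν ≤ 8 * (1 - α) * logDist (1 / (1 + goldenRatio)) := by
  have := h.1
  have hα' : α ∈ Set.Icc (0 : ℝ) 1 := ⟨by linarith [hα.1], hα.2⟩
  have hpos := h.ae_pos hα'
  set c := logDist (1 / (1 + goldenRatio))
  have hc : 0 ≤ c := logDist_nonneg _
  have hmeas : Measurable fun x => min (logDist x) M := measurable_logDist.min measurable_const
  have hint : ∀ u : ℝ → ℝ, Measurable u → Integrable (fun x => min (logDist (u x)) M) ν :=
    fun u hu => Integrable.of_bound (hmeas.comp hu).aestronglyMeasurable M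
      (Eventually.of_forall fun x => by
        rw [Real.norm_of_nonneg (le_min (logDist_nonneg _) (by linarith))]
        exact min_le_right _ _)
  have hg := measurable_one_add_inv
  have hl := measurable_inv_one_add
  have h0 := hint _ measurable_id
  simp only [id] at h0
  have e1 := h.integral_eq hα' h0 hmeas
  have e2 := h.integral_eq hα' (hint _ hg) (hmeas.comp hg)
  have hadd : ∫ x, (min (logDist x) M + c) ∂ν = ∫ x, min (logDist x) M ∂ν + c := by
    rw [integral_add h0 (integrable_const _)]; simp
  have b1 : ∫ x, min (logDist (1 + 1 / (1 + 1 / x))) M ∂ν ≤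
      (∫ x, min (logDist x) M ∂ν) / 2 := by
    rw [← integral_div]
    refine integral_mono_ae (hint _ (hg.comp hg)) (h0.div_const 2) ?_
    filter_upwards [hpos] with x hx
    have := logDist_one_add_inv_iterate_le hx
    have := logDist_one_add_inv_iterate_le_one hx
    refine (min_le_left _ _).trans ?_
    rcases min_choice (logDist x) M with h | h <;> rw [h] <;> linarith
  have b2 : ∫ x, min (logDist (1 / (1 + x))) M ∂ν ≤ ∫ x, min (logDist x) M ∂ν + c := by
    rw [← hadd]
    refine integral_mono_ae (hint _ hl) (h0.add (integrable_const _)) ?_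
    filter_upwards [hpos] with x hx
    have := logDist_inv_one_add_le hx
    rw [← min_add_add_right]
    exact min_le_min this (by linarith)
  have b3 : ∫ x, min (logDist (1 + 1 / (1 / (1 + x)))) M ∂ν ≤
      ∫ x, min (logDist (1 / (1 + x))) M ∂ν := by
    refine integral_mono_ae (hint _ (hg.comp hl)) (hint _ hl) ?_
    filter_upwards [hpos] with x hx
    exact min_le_min_right _ (logDist_one_add_inv_le (by positivity))
  have hI : 0 ≤ ∫ x, min (logDist x) M ∂ν :=
    integral_nonneg fun x => le_min (logDist_nonneg _) (by
      simp only [Pi.zero_apply]; linarith)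
  have hL : 0 ≤ ∫ x, min (logDist (1 / (1 + x))) M ∂ν :=
    integral_nonneg fun x => le_min (logDist_nonneg _) (by
      simp only [Pi.zero_apply]; linarith)
  revert e1 e2 b1 b2 b3 hI hL
  generalize ∫ x, min (logDist x) M ∂ν = I
  generalize ∫ x, min (logDist (1 + 1 / x)) M ∂ν = G
  generalize ∫ x, min (logDist (1 / (1 + x))) M ∂ν = L
  generalize ∫ x, min (logDist (1 + 1 / (1 + 1 / x))) M ∂ν = GG
  generalize ∫ x, min (logDist (1 + 1 / (1 / (1 + x)))) M ∂ν = K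
  intro e1 e2 b1 b2 b3 hI hL
  have hε := sub_nonneg.2 hα.2
  have h1 : α * GG ≤ I / 2 :=
    (mul_le_mul_of_nonneg_left b1 hα'.1).trans (mul_le_of_le_one_left (by linarith) hα.2)
  have h2 : (1 - α) * L ≤ (1 - α) * (I + c) := mul_le_mul_of_nonneg_left b2 hε
  have h3 : (1 - α) * K ≤ (1 - α) * (I + c) := mul_le_mul_of_nonneg_left (b3.trans b2) hε
  have h4 : α * G ≤ I / 2 + (1 - α) * (I + c) := by
    refine (mul_le_mul_of_nonneg_left (e2.le.trans (add_le_add h1 h3)) hα'.1).trans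
      (mul_le_of_le_one_left (by positivity) hα.2)
  have h5 : (1 - α) * I ≤ 1 / 8 * I := mul_le_mul_of_nonneg_right (by linarith [hα.1]) hI
  linarith

theorem lintegral_logDist_le (h : IsSternBrocotMeasure α ν) (hα : α ∈ Set.Icc (7 / 8 : ℝ) 1) :
    ∫⁻ x, ENNReal.ofReal (logDist x) ∂ν ≤
      ENNReal.ofReal (8 * (1 - α) * logDist (1 / (1 + goldenRatio))) := by
  have := h.1
  have hlim : Tendsto (fun n : ℕ => ∫⁻ x, ENNReal.ofReal (min (logDist x) (n + 2)) ∂ν) atTop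
      (𝓝 (∫⁻ x, ENNReal.ofReal (logDist x) ∂ν)) := by
    refine lintegral_tendsto_of_tendsto_of_monotone (fun n => ?_) ?_ ?_
    · exact (measurable_logDist.min measurable_const).ennreal_ofReal.aemeasurable
    · refine Eventually.of_forall fun x m n hmn => ENNReal.ofReal_le_ofReal ?_
      exact min_le_min_left _ (by gcongr)
    · refine Eventually.of_forall fun x => tendsto_const_nhds.congr' ?_
      filter_upwards [eventually_ge_atTop ⌈logDist x⌉₊] with n hn
      rw [min_eq_left]
      linarith [Nat.ceil_le.1 hn]
  refine le_of_tendsto' hlim fun n => ?_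
  have hn : (0 : ℝ) ≤ n := n.cast_nonneg
  rw [← ofReal_integral_eq_lintegral_ofReal]
  · exact ENNReal.ofReal_le_ofReal (h.integral_min_logDist_le hα (by linarith))
  · refine Integrable.of_bound
      (measurable_logDist.min measurable_const).aestronglyMeasurable (n + 2)
      (Eventually.of_forall fun x => ?_)
    rw [Real.norm_of_nonneg (le_min (logDist_nonneg _) (by linarith))]
    exact min_le_right _ _
  · exact Eventually.of_forall fun x => le_min (logDist_nonneg _) (by simp; linarith)

theorem integrable_logDist (h : IsSternBrocotMeasure α ν) (hα : α ∈ Set.Icc (7 / 8 : ℝ) 1) :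
    Integrable logDist ν := by
  refine ⟨measurable_logDist.aestronglyMeasurable, ?_⟩
  rw [hasFiniteIntegral_iff_ofReal (Eventually.of_forall logDist_nonneg)]
  exact (h.lintegral_logDist_le hα).trans_lt ENNReal.ofReal_lt_top

theorem integral_logDist_le (h : IsSternBrocotMeasure α ν) (hα : α ∈ Set.Icc (7 / 8 : ℝ) 1) :
    ∫ x, logDist x ∂ν ≤ 8 * (1 - α) * logDist (1 / (1 + goldenRatio)) := by
  have hnonneg : 0 ≤ 8 * (1 - α) * logDist (1 / (1 + goldenRatio)) :=
    mul_nonneg (by linarith [hα.2]) (logDist_nonneg _)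
  rw [← ENNReal.ofReal_le_ofReal_iff hnonneg, ofReal_integral_eq_lintegral_ofReal
    (h.integrable_logDist hα) (Eventually.of_forall logDist_nonneg)]
  exact h.lintegral_logDist_le hα

theorem integrable_and_abs_integral_sub_le (h : IsSternBrocotMeasure α ν)
    (hα : α ∈ Set.Icc (7 / 8 : ℝ) 1) {f : ℝ → ℝ} (hf : Measurable f) {c : ℝ}
    (hfc : ∀ x, 0 < x → |f x - c| ≤ logDist x) :
    Integrable f ν ∧
      |∫ x, f x ∂ν - c| ≤ 8 * (1 - α) * logDist (1 / (1 + goldenRatio)) := by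
  have := h.1
  have hpos := h.ae_pos ⟨by linarith [hα.1], hα.2⟩
  have hd := h.integrable_logDist hα
  have hsub : Integrable (fun x => f x - c) ν :=
    hd.mono' (hf.sub_const c).aestronglyMeasurable (hpos.mono hfc)
  have hfi : Integrable f ν := 
    (hsub.add (integrable_const c)).congr (Eventually.of_forall fun x => by simp)
  refine ⟨hfi, ?_⟩
  have : ∫ x, f x ∂ν - c = ∫ x, (f x - c) ∂ν := by
    rw [integral_sub hfi (integrable_const c)]; simp
  rw [this]
  exact (abs_integral_le_integral_abs.trans
    (integral_mono_ae hsub.abs hd (hpos.mono hfc))).trans (h.integral_logDist_le hα)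

theorem abs_integral_log_sub_le (h : IsSternBrocotMeasure α ν)
    (hα : α ∈ Set.Icc (7 / 8 : ℝ) 1) :
    |∫ x, Real.log x ∂ν - Real.log goldenRatio - (α - 1) * (Real.log 5 / 2)| ≤
      16 * logDist (1 / (1 + goldenRatio)) * (α - 1) ^ 2 := by
  have := h.1
  have hα' : α ∈ Set.Icc (0 : ℝ) 1 := ⟨by linarith [hα.1], hα.2⟩
  have hpos := h.ae_pos hα'
  have hφ := Real.goldenRatio_pos
  have hφinv : 0 < 1 / goldenRatio := by positivity
  have hφsq := Real.goldenRatio_sq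
  have hmeas : Measurable fun x => Real.log (x + 1 / goldenRatio) := by fun_prop
  have hlog := h.integrable_and_abs_integral_sub_le hα Real.measurable_log
    (c := Real.log goldenRatio) fun x hx => le_rfl
  have hf := h.integrable_and_abs_integral_sub_le hα hmeas fun x hx =>
    abs_log_add_const_sub_le hφinv hx hφ
  have hg := h.integrable_and_abs_integral_sub_le hα (hmeas.comp measurable_one_add_inv)
    fun x hx => (abs_log_add_const_sub_le (x := 1 + 1 / x) hφinv (by positivity) hφ).trans
      (logDist_one_add_inv_le hx)
  have hl := h.integrable_and_abs_integral_sub_le hα (hmeas.comp measurable_inv_one_add)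
    fun x hx => (abs_log_add_const_sub_le (x := 1 / (1 + x)) (y := 1 / (1 + goldenRatio)) hφinv
      (by positivity) (by positivity)).trans (abs_log_inv_one_add_sub_le hx hφ)
  have e := h.integral_eq hα' hf.1 hmeas
  have hgolden : 1 / (1 + goldenRatio) + 1 / goldenRatio = 1 := by
    clear * - hφsq hφ
    generalize goldenRatio = φ at *
    field_simp; linarith
  have hsqrt : goldenRatio + 1 / goldenRatio = √5 := by
    have h1 := one_add_inv_goldenRatio
    have h2 : goldenRatio = (1 + √5) / 2 := rfl
    linarith
  rw [hgolden, Real.log_one] at hl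
  rw [hsqrt, Real.log_sqrt (by norm_num)] at hg
  have key : ∫ x, Real.log x ∂ν - Real.log goldenRatio =
      ∫ x, Real.log (x + 1 / goldenRatio) ∂ν -
        ∫ x, Real.log (1 + 1 / x + 1 / goldenRatio) ∂ν := by
    have h1 : ∫ x, Real.log x ∂ν - Real.log goldenRatio =
        ∫ x, (Real.log x - Real.log goldenRatio) ∂ν := by
      rw [integral_sub hlog.1 (integrable_const _)]; simp
    have hg' : Integrable (fun x => Real.log (1 + 1 / x + 1 / goldenRatio)) ν := hg.1
    rw [h1, ← integral_sub hf.1 hg']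
    refine integral_congr_ae ?_
    filter_upwards [hpos] with x hx
    rw [sub_eq_sub_iff_add_eq_add]
    rw [← Real.log_mul (by positivity) (by positivity),
      ← Real.log_mul (by positivity) (by positivity)]
    congr 1
    clear * - hφsq hφ hx
    generalize goldenRatio = φ at *
    field_simp
    linear_combination -x * hφsq
  rw [key, e]
  simp only [Function.comp] at hg hl
  revert hg hl
  generalize ∫ x, Real.log (1 + 1 / x + 1 / goldenRatio) ∂ν = G
  generalize ∫ x, Real.log (1 / (1 + x) + 1 / goldenRatio) ∂ν = L
  generalize logDist (1 / (1 + goldenRatio)) = c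
  rintro ⟨-, hg⟩ ⟨-, hl⟩
  have hε := sub_nonneg.2 hα.2
  have h1 : α * G + (1 - α) * L - G - (α - 1) * (Real.log 5 / 2) =
      (1 - α) * ((L - 0) - (G - Real.log 5 / 2)) := by ring
  rw [h1, abs_mul, abs_of_nonneg hε]
  refine (mul_le_mul_of_nonneg_left ((abs_sub _ _).trans (add_le_add hl hg)) hε).trans ?_
  exact le_of_eq (by ring)

end IsSternBrocotMeasure

theorem hasDerivWithinAt_integral_log {ν : ℝ → Measure ℝ}
    (hν : ∀ α ∈ Set.Icc (0 : ℝ) 1, IsSternBrocotMeasure α (ν α)) :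
    HasDerivWithinAt (fun α => ∫ x, Real.log x ∂(ν α)) (Real.log 5 / 2) (Set.Icc 0 1) 1 := by
  have hbound : ∀ α ∈ Set.Icc (7 / 8 : ℝ) 1, _ := fun α hα =>
    (hν α ⟨by linarith [hα.1], hα.2⟩).abs_integral_log_sub_le hα
  have h1 := hbound 1 (by norm_num)
  rw [sub_self, zero_mul, sub_zero, zero_pow two_ne_zero, mul_zero, abs_nonpos_iff,
    sub_eq_zero] at h1
  rw [hasDerivWithinAt_iff_isLittleO, h1]
  have hO : (fun α => ∫ x, Real.log x ∂(ν α) - Real.log goldenRatio - (α - 1) • (Real.log 5 / 2))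
      =O[𝓝[Set.Icc 0 1] 1] fun α => (α - 1) ^ 2 := by
    refine Asymptotics.IsBigO.of_bound (16 * logDist (1 / (1 + goldenRatio))) ?_
    filter_upwards [self_mem_nhdsWithin,
      nhdsWithin_le_nhds (Ici_mem_nhds (by norm_num : (7 / 8 : ℝ) < 1))] with α hα hα'
    rw [Real.norm_eq_abs, Real.norm_of_nonneg (sq_nonneg _)]
    exact hbound α ⟨hα', hα.2⟩
  refine hO.trans_isLittleO ?_
  have := (Asymptotics.isLittleO_pow_sub_sub (1 : ℝ) (m := 2) one_lt_two)
  simpa using this.mono nhdsWithin_le_nhds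

theorem hasDerivAt_alpha :
    HasDerivAt (fun p : ℝ => (3 * p - 2 + Real.sqrt (5 * p ^ 2 - 8 * p + 4)) / (2 * p)) 1 1 := by
  have hpoly : HasDerivAt (fun p : ℝ => 5 * p ^ 2 - 8 * p + 4) 2 1 := by
    have := ((((hasDerivAt_id (1 : ℝ)).pow 2).const_mul 5).sub
      ((hasDerivAt_id (1 : ℝ)).const_mul 8)).add_const 4
    refine this.congr_deriv ?_
    norm_num
  have h := ((((hasDerivAt_id (1 : ℝ)).const_mul 3).sub_const 2).add
    (hpoly.sqrt (by norm_num))).div ((hasDerivAt_id (1 : ℝ)).const_mul 2) (by norm_num)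
  refine h.congr_deriv ?_
  norm_num

theorem alpha_mem_Icc {p : ℝ} (hp : p ∈ Set.Ioc (0 : ℝ) 1) :
    (3 * p - 2 + Real.sqrt (5 * p ^ 2 - 8 * p + 4)) / (2 * p) ∈ Set.Icc (0 : ℝ) 1 := by
  obtain ⟨h0, h1⟩ := hp
  have hlow : 2 - 3 * p ≤ Real.sqrt (5 * p ^ 2 - 8 * p + 4) :=
    Real.le_sqrt_of_sq_le (by nlinarith)
  have hup : Real.sqrt (5 * p ^ 2 - 8 * p + 4) ≤ 2 - p :=
    Real.sqrt_le_iff.2 ⟨by linarith, by nlinarith⟩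
  exact ⟨div_nonneg (by linarith) (by linarith), (div_le_one (by linarith)).2 (by linarith)⟩

/-- The map `p ↦ γ_p = ∫ log x dν_{α(p)}(x)`, with `α(p) = (3p - 2 + √(5p² - 8p + 4))/(2p)`,
has derivative `(log 5)/2` at `p = 1` within `(0,1]`. -/
theorem gamma_hasDerivWithinAt_one
    (ν : ℝ → Measure ℝ) (hν : ∀ α ∈ Set.Icc (0 : ℝ) 1, IsSternBrocotMeasure α (ν α)) :
    HasDerivWithinAt (fun p : ℝ =>
        ∫ x, Real.log x ∂(ν ((3 * p - 2 + Real.sqrt (5 * p ^ 2 - 8 * p + 4)) / (2 * p))))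
      (Real.log 5 / 2) (Set.Ioc 0 1) 1 := by
  have hone : (3 * 1 - 2 + Real.sqrt (5 * 1 ^ 2 - 8 * 1 + 4)) / (2 * 1) = 1 := by norm_num
  have h := (hasDerivWithinAt_integral_log hν).comp_of_eq (1 : ℝ)
    hasDerivAt_alpha.hasDerivWithinAt (fun p hp => alpha_mem_Icc hp) hone.symm
  rwa [mul_one] at h
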